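/- Subject Reduction: assume there is an NMLL derivation of the sequent Π ⇒ t₁:F₁, …, tₙ:Fₙ, t_{n+1}, …, t_m (the last m−n terms untyped). If t₁ ∣ … ∣ t_m reduces in one step of λ∥ to t₁' ∣ … ∣ t_m', then there is an NMLL derivation of Π ⇒ t₁':F₁, …, tₙ':Fₙ, t_{n+1}', …, t_m'. -/

import Mathlib

/- Types of multiplicative linear logic: propositional variables, ⊥, ⊸, ⅋ -/
inductive Ty : Type
  | pvar : ℕ → Ty
  | bot : Ty
  | limp : Ty → Ty → Ty
  | parr : Ty → Ty → Ty
  deriving DecidableEq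

/- Untyped terms of λ∥ -/
inductive Tm : Type
  | unit : Tm                    -- ∘ (terminated process)
  | out : ℕ → Tm → Tm            -- x̄ u (output channel with continuation; λx u when x occurs in u)
  | out2 : ℕ → ℕ → Tm → Tm       -- x̄ȳ u (output channels without continuation)
  | par : Tm → Tm → Tm           -- u ∣ v
  | close : Tm → Tm              -- close(u)
  | var : ℕ → Tm                 -- variable x
  | app : Tm → Tm → Tm           -- application u v
  deriving DecidableEq

namespace Tm

/-- number of occurrences of the variable (input channel) x in a term -/
def varOcc (x : ℕ) : Tm → ℕ
  | unit => 0
  | out _ u => varOcc x u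
  | out2 _ _ u => varOcc x u
  | par u v => varOcc x u + varOcc x v
  | close u => varOcc x u
  | var y => if y = x then 1 else 0
  | app u v => varOcc x u + varOcc x v

/-- number of occurrences of the output binder x̄ in a term -/
def outOcc (x : ℕ) : Tm → ℕ
  | unit => 0
  | out y u => (if y = x then 1 else 0) + outOcc x u
  | out2 y z u => (if y = x then 1 else 0) + (if z = x then 1 else 0) + outOcc x u
  | par u v => outOcc x u + outOcc x v
  | close u => outOcc x u
  | var _ => 0
  | app u v => outOcc x u + outOcc x v

/-- literal substitution of the term v for the variable x (no renaming) -/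
def subst (x : ℕ) (v : Tm) : Tm → Tm
  | unit => unit
  | out y u => out y (subst x v u)
  | out2 y z u => out2 y z (subst x v u)
  | par u w => par (subst x v u) (subst x v w)
  | close u => close (subst x v u)
  | var y => if y = x then v else var y
  | app u w => app (subst x v u) (subst x v w)

/-- communication-size: number of occurrences of the operators x̄ and x̄ȳ -/
def cs : Tm → ℕ
  | unit => 0
  | out _ u => cs u + 1
  | out2 _ _ u => cs u + 1
  | par u v => cs u + cs v
  | close u => cs u
  | var _ => 0
  | app u v => cs u + cs v

/-- values: terms of the form x̄ t or s ∣ t -/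
def IsValue : Tm → Prop
  | out _ _ => True
  | par _ _ => True
  | _ => False

end Tm

/- one-hole contexts -/
inductive Ctx : Type
  | hole : Ctx
  | out : ℕ → Ctx → Ctx
  | out2 : ℕ → ℕ → Ctx → Ctx
  | parL : Ctx → Tm → Ctx
  | parR : Tm → Ctx → Ctx
  | close : Ctx → Ctx
  | appL : Ctx → Tm → Ctx
  | appR : Tm → Ctx → Ctx

namespace Ctx

def fill : Ctx → Tm → Tm
  | hole, t => t
  | out x C, t => Tm.out x (fill C t)
  | out2 x y C, t => Tm.out2 x y (fill C t)
  | parL C u, t => Tm.par (fill C t) u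
  | parR u C, t => Tm.par u (fill C t)
  | close C, t => Tm.close (fill C t)
  | appL C u, t => Tm.app (fill C t) u
  | appR u C, t => Tm.app u (fill C t)

/-- a context is simple if it has no subterm of the form D[ ]∣u or u∣D[ ] -/
def Simple : Ctx → Prop
  | hole => True
  | out _ C => Simple C
  | out2 _ _ C => Simple C
  | parL _ _ => False
  | parR _ _ => False
  | close C => Simple C
  | appL C _ => Simple C
  | appR _ C => Simple C

/-- occurrences of the variable x in the context (not counting the hole) -/
def varOcc (x : ℕ) : Ctx → ℕ
  | hole => 0
  | out _ C => varOcc x C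
  | out2 _ _ C => varOcc x C
  | parL C u => varOcc x C + Tm.varOcc x u
  | parR u C => Tm.varOcc x u + varOcc x C
  | close C => varOcc x C
  | appL C u => varOcc x C + Tm.varOcc x u
  | appR u C => Tm.varOcc x u + varOcc x C

end Ctx

/- two-hole contexts D[ ][ ] -/
inductive Ctx2 : Type
  | out : ℕ → Ctx2 → Ctx2
  | out2 : ℕ → ℕ → Ctx2 → Ctx2
  | close : Ctx2 → Ctx2
  | parLL : Ctx2 → Tm → Ctx2
  | parRR : Tm → Ctx2 → Ctx2
  | parLR : Ctx → Ctx → Ctx2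
  | parRL : Ctx → Ctx → Ctx2
  | appLL : Ctx2 → Tm → Ctx2
  | appRR : Tm → Ctx2 → Ctx2
  | appLR : Ctx → Ctx → Ctx2
  | appRL : Ctx → Ctx → Ctx2

def Ctx2.fill : Ctx2 → Tm → Tm → Tm
  | .out x C, a, b => Tm.out x (Ctx2.fill C a b)
  | .out2 x y C, a, b => Tm.out2 x y (Ctx2.fill C a b)
  | .close C, a, b => Tm.close (Ctx2.fill C a b)
  | .parLL C u, a, b => Tm.par (Ctx2.fill C a b) u
  | .parRR u C, a, b => Tm.par u (Ctx2.fill C a b)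
  | .parLR C D, a, b => Tm.par (Ctx.fill C a) (Ctx.fill D b)
  | .parRL C D, a, b => Tm.par (Ctx.fill C b) (Ctx.fill D a)
  | .appLL C u, a, b => Tm.app (Ctx2.fill C a b) u
  | .appRR u C, a, b => Tm.app u (Ctx2.fill C a b)
  | .appLR C D, a, b => Tm.app (Ctx.fill C a) (Ctx.fill D b)
  | .appRL C D, a, b => Tm.app (Ctx.fill C b) (Ctx.fill D a)

/- one-step reduction of λ∥ -/
inductive Step : Tm → Tm → Prop
  /- β-reduction (λx u)t ↦ u[t/x], where λx u is x̄u with x occurring in u -/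
  | beta (x : ℕ) (u t : Tm) (hx : 0 < Tm.varOcc x u) :
      Step (Tm.app (Tm.out x u) t) (Tm.subst x t u)
  /- communication C[x̄⟨s⟩u] ∣ D[x] ↦ C[s] ∣ D[u] -/
  | comm1 (C D : Ctx) (x : ℕ) (s u : Tm) :
      Step (Tm.par (C.fill (Tm.app (Tm.out x s) u)) (D.fill (Tm.var x)))
           (Tm.par (C.fill s) (D.fill u))
  /- communication C[x] ∣ D[x̄⟨s⟩u] ↦ C[u] ∣ D[s] -/
  | comm2 (C D : Ctx) (x : ℕ) (s u : Tm) :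
      Step (Tm.par (C.fill (Tm.var x)) (D.fill (Tm.app (Tm.out x s) u)))
           (Tm.par (C.fill u) (D.fill s))
  /- C[x̄ȳ(s∣t)] ∣ D[x][y] ↦ C[∘] ∣ D[s][t] -/
  | pa1 (C : Ctx) (D : Ctx2) (x y : ℕ) (s t : Tm) :
      Step (Tm.par (C.fill (Tm.out2 x y (Tm.par s t))) (D.fill (Tm.var x) (Tm.var y)))
           (Tm.par (C.fill Tm.unit) (D.fill s t))
  /- D[x][y] ∣ C[x̄ȳ(s∣t)] ↦ D[s][t] ∣ C[∘] -/
  | pa2 (C : Ctx) (D : Ctx2) (x y : ℕ) (s t : Tm) :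
      Step (Tm.par (D.fill (Tm.var x) (Tm.var y)) (C.fill (Tm.out2 x y (Tm.par s t))))
           (Tm.par (D.fill s t) (C.fill Tm.unit))
  /- D[x] ∣ C[x̄ȳ(s∣t)] ∣ E[y] ↦ D[s] ∣ C[∘] ∣ E[t]  (both associations) -/
  | pa3l (C D E : Ctx) (x y : ℕ) (s t : Tm) :
      Step (Tm.par (Tm.par (D.fill (Tm.var x)) (C.fill (Tm.out2 x y (Tm.par s t)))) (E.fill (Tm.var y)))
           (Tm.par (Tm.par (D.fill s) (C.fill Tm.unit)) (E.fill t))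
  | pa3r (C D E : Ctx) (x y : ℕ) (s t : Tm) :
      Step (Tm.par (D.fill (Tm.var x)) (Tm.par (C.fill (Tm.out2 x y (Tm.par s t))) (E.fill (Tm.var y))))
           (Tm.par (D.fill s) (Tm.par (C.fill Tm.unit) (E.fill t)))
  /- D[y] ∣ C[x̄ȳ(s∣t)] ∣ E[x] ↦ D[t] ∣ C[∘] ∣ E[s]  (both associations) -/
  | pa4l (C D E : Ctx) (x y : ℕ) (s t : Tm) :
      Step (Tm.par (Tm.par (D.fill (Tm.var y)) (C.fill (Tm.out2 x y (Tm.par s t)))) (E.fill (Tm.var x)))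
           (Tm.par (Tm.par (D.fill t) (C.fill Tm.unit)) (E.fill s))
  | pa4r (C D E : Ctx) (x y : ℕ) (s t : Tm) :
      Step (Tm.par (D.fill (Tm.var y)) (Tm.par (C.fill (Tm.out2 x y (Tm.par s t))) (E.fill (Tm.var x))))
           (Tm.par (D.fill t) (Tm.par (C.fill Tm.unit) (E.fill s)))
  /- closure under arbitrary contexts -/
  | ctx (C : Ctx) {t u : Tm} (h : Step t u) : Step (C.fill t) (C.fill u)

/-- a term is normal if no reduction applies to it -/
def NormalTm (t : Tm) : Prop := ∀ u, ¬ Step t u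

/-- parallel composition t₁ ∣ … ∣ tₘ of a list of terms -/
def bigPar : List Tm → Tm
  | [] => Tm.unit
  | t :: ts => ts.foldl Tm.par t

/- entries of the right-hand side of an NMLL sequent: a term with an optional type -/
abbrev Entry := Tm × Option Ty

/-- the variable z is used in the sequent Γ ⇒ Δ (declared in Γ, or occurring
    as a variable or as an output binder in a term of Δ) -/
def UsedIn (Γ : Multiset (ℕ × Ty)) (Δ : Multiset Entry) (z : ℕ) : Prop :=
  (∃ A, (z, A) ∈ Γ) ∨ ∃ e ∈ Δ, 0 < Tm.varOcc z e.1 ∨ 0 < Tm.outOcc z e.1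

/-- two sequents share no variable -/
def SeqDisj (Γ₁ : Multiset (ℕ × Ty)) (Δ₁ : Multiset Entry)
    (Γ₂ : Multiset (ℕ × Ty)) (Δ₂ : Multiset Entry) : Prop :=
  ∀ z, ¬ (UsedIn Γ₁ Δ₁ z ∧ UsedIn Γ₂ Δ₂ z)

/- the multiple-conclusion natural deduction typing system NMLL -/
inductive NMLL : Multiset (ℕ × Ty) → Multiset Entry → Type
  | ax (x : ℕ) (A : Ty) : NMLL {(x, A)} {(Tm.var x, some A)}
  /- ⊸I (both variants: x occurs in t, or x occurs in Δ) -/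
  | limpI {Γ : Multiset (ℕ × Ty)} {Δ : Multiset Entry} (x : ℕ) (A B : Ty) (t : Tm)
      (d : NMLL ((x, A) ::ₘ Γ) ((t, some B) ::ₘ Δ))
      (hx : 0 < Tm.varOcc x t ∨ ∃ e ∈ Δ, 0 < Tm.varOcc x e.1) :
      NMLL Γ ((Tm.out x t, some (Ty.limp A B)) ::ₘ Δ)
  /- ⊸E -/
  | limpE {Γ Φ : Multiset (ℕ × Ty)} {Δ Θ : Multiset Entry} (s t : Tm) (A B : Ty)
      (d1 : NMLL Γ ((s, some (Ty.limp A B)) ::ₘ Δ))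
      (d2 : NMLL Φ ((t, some A) ::ₘ Θ))
      (h : SeqDisj Γ ((s, some (Ty.limp A B)) ::ₘ Δ) Φ ((t, some A) ::ₘ Θ)) :
      NMLL (Γ + Φ) ((Tm.app s t, some B) ::ₘ (Δ + Θ))
  /- ⅋I -/
  | parrI {Γ : Multiset (ℕ × Ty)} {Δ : Multiset Entry} (s t : Tm) (A B : Ty)
      (d : NMLL Γ ((s, some A) ::ₘ (t, some B) ::ₘ Δ)) :
      NMLL Γ ((Tm.par s t, some (Ty.parr A B)) ::ₘ Δ)
  /- ⅋E -/
  | parrE {Γ Φ₁ Φ₂ : Multiset (ℕ × Ty)} {Δ Θ₁ Θ₂ : Multiset Entry}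
      (s : Tm) (x y : ℕ) (A B : Ty)
      (d1 : NMLL Γ ((s, some (Ty.parr A B)) ::ₘ Δ))
      (d2 : NMLL ((x, A) ::ₘ Φ₁) Θ₁)
      (d3 : NMLL ((y, B) ::ₘ Φ₂) Θ₂)
      (h12 : SeqDisj Γ ((s, some (Ty.parr A B)) ::ₘ Δ) ((x, A) ::ₘ Φ₁) Θ₁)
      (h13 : SeqDisj Γ ((s, some (Ty.parr A B)) ::ₘ Δ) ((y, B) ::ₘ Φ₂) Θ₂)
      (h23 : SeqDisj ((x, A) ::ₘ Φ₁) Θ₁ ((y, B) ::ₘ Φ₂) Θ₂) :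
      NMLL (Γ + Φ₁ + Φ₂) ((Tm.out2 x y s, some Ty.bot) ::ₘ (Δ + Θ₁ + Θ₂))
  /- ⊥I -/
  | botI {Γ : Multiset (ℕ × Ty)} {Δ : Multiset Entry} (d : NMLL Γ Δ) :
      NMLL Γ ((Tm.unit, some Ty.bot) ::ₘ Δ)
  /- ⊥E -/
  | botE {Γ : Multiset (ℕ × Ty)} {Δ : Multiset Entry} (t : Tm)
      (d : NMLL Γ ((t, some Ty.bot) ::ₘ Δ)) :
      NMLL Γ ((Tm.close t, none) ::ₘ Δ)

/- the two-sided sequent calculus MLL for classical multiplicative linear logic -/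
inductive MLL : Multiset Ty → Multiset Ty → Prop
  | ax (A : Ty) : MLL {A} {A}
  | botL : MLL {Ty.bot} 0
  | botR {Γ Δ : Multiset Ty} (h : MLL Γ Δ) : MLL Γ (Ty.bot ::ₘ Δ)
  | limpL {Γ Φ Δ Θ : Multiset Ty} {A B : Ty}
      (h1 : MLL Γ (A ::ₘ Δ)) (h2 : MLL (B ::ₘ Φ) Θ) :
      MLL (Ty.limp A B ::ₘ (Γ + Φ)) (Δ + Θ)
  | limpR {Γ Δ : Multiset Ty} {A B : Ty} (h : MLL (A ::ₘ Γ) (B ::ₘ Δ)) :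
      MLL Γ (Ty.limp A B ::ₘ Δ)
  | parrL {Γ Φ Δ Θ : Multiset Ty} {A B : Ty}
      (h1 : MLL (A ::ₘ Γ) Δ) (h2 : MLL (B ::ₘ Φ) Θ) :
      MLL (Ty.parr A B ::ₘ (Γ + Φ)) (Δ + Θ)
  | parrR {Γ Δ : Multiset Ty} {A B : Ty} (h : MLL Γ (A ::ₘ B ::ₘ Δ)) :
      MLL Γ (Ty.parr A B ::ₘ Δ)
  | cut {Γ Φ Δ Θ : Multiset Ty} {A : Ty}
      (h1 : MLL Γ (A ::ₘ Δ)) (h2 : MLL (A ::ₘ Φ) Θ) :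
      MLL (Γ + Φ) (Δ + Θ)

/-- the subformula relation on types (reflexive-transitive closure of immediate subformula) -/
inductive Subformula : Ty → Ty → Prop
  | refl (A : Ty) : Subformula A A
  | limpL {S A B : Ty} (h : Subformula S A) : Subformula S (Ty.limp A B)
  | limpR {S A B : Ty} (h : Subformula S B) : Subformula S (Ty.limp A B)
  | parrL {S A B : Ty} (h : Subformula S A) : Subformula S (Ty.parr A B)
  | parrR {S A B : Ty} (h : Subformula S B) : Subformula S (Ty.parr A B)

/-- the types occurring in a sequent -/
def seqTys (Γ : Multiset (ℕ × Ty)) (Δ : Multiset Entry) : Multiset Ty :=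
  Γ.map Prod.snd + Δ.filterMap Prod.snd

/-- all types occurring (in some sequent) in a derivation -/
def NMLL.tys : {Γ : Multiset (ℕ × Ty)} → {Δ : Multiset Entry} → NMLL Γ Δ → Multiset Ty
  | _, _, @NMLL.ax x A => seqTys {(x, A)} {(Tm.var x, some A)}
  | _, _, @NMLL.limpI Γ Δ x A B t d _ =>
      seqTys Γ ((Tm.out x t, some (Ty.limp A B)) ::ₘ Δ) + d.tys
  | _, _, @NMLL.limpE Γ Φ Δ Θ s t A B d1 d2 _ =>
      seqTys (Γ + Φ) ((Tm.app s t, some B) ::ₘ (Δ + Θ)) + d1.tys + d2.tys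
  | _, _, @NMLL.parrI Γ Δ s t A B d =>
      seqTys Γ ((Tm.par s t, some (Ty.parr A B)) ::ₘ Δ) + d.tys
  | _, _, @NMLL.parrE Γ Φ₁ Φ₂ Δ Θ₁ Θ₂ s x y A B d1 d2 d3 _ _ _ =>
      seqTys (Γ + Φ₁ + Φ₂) ((Tm.out2 x y s, some Ty.bot) ::ₘ (Δ + Θ₁ + Θ₂))
        + d1.tys + d2.tys + d3.tys
  | _, _, @NMLL.botI Γ Δ d => seqTys Γ ((Tm.unit, some Ty.bot) ::ₘ Δ) + d.tys
  | _, _, @NMLL.botE Γ Δ t d => seqTys Γ ((Tm.close t, none) ::ₘ Δ) + d.tys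

/-- total number of occurrences of the variable x in the terms of Δ -/
def varOccM (x : ℕ) (Δ : Multiset Entry) : ℕ := (Δ.map (fun e => Tm.varOcc x e.1)).sum

/-- total number of occurrences of the output binder x̄ in the terms of Δ -/
def outOccM (x : ℕ) (Δ : Multiset Entry) : ℕ := (Δ.map (fun e => Tm.outOcc x e.1)).sum

namespace Tm

/-- the name z occurs in t, as a variable or as an output binder -/
def Used (z : ℕ) (t : Tm) : Prop := 0 < varOcc z t ∨ 0 < outOcc z t

/-- r is a subterm of the given term -/
def HasSub (r : Tm) : Tm → Prop
  | unit => unit = r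
  | out y u => out y u = r ∨ HasSub r u
  | out2 y z u => out2 y z u = r ∨ HasSub r u
  | par u v => par u v = r ∨ HasSub r u ∨ HasSub r v
  | close u => close u = r ∨ HasSub r u
  | var y => var y = r
  | app u v => app u v = r ∨ HasSub r u ∨ HasSub r v

/-- replace the subterm r by b and, outside r, the variables according to σ -/
def repl (r b : Tm) (σ : ℕ → Tm) : Tm → Tm
  | unit => if unit = r then b else unit
  | out y u => if out y u = r then b else out y (repl r b σ u)
  | out2 y z u => if out2 y z u = r then b else out2 y z (repl r b σ u)
  | par u v => if par u v = r then b else par (repl r b σ u) (repl r b σ v)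
  | close u => if close u = r then b else close (repl r b σ u)
  | var y => if var y = r then b else σ y
  | app u v => if app u v = r then b else app (repl r b σ u) (repl r b σ v)

variable {r b : Tm} {σ : ℕ → Tm}

theorem hasSub_refl (r : Tm) : HasSub r r := by
  cases r <;> simp [HasSub]

theorem repl_self : repl r b σ r = b := by
  cases r <;> simp [repl]

theorem HasSub.varOcc_le {t : Tm} (h : HasSub r t) (z : ℕ) : varOcc z r ≤ varOcc z t := by
  induction t <;> simp only [HasSub] at h <;> grind [varOcc]

theorem HasSub.outOcc_le {t : Tm} (h : HasSub r t) (z : ℕ) : outOcc z r ≤ outOcc z t := by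
  induction t <;> simp only [HasSub] at h <;> grind [outOcc]

theorem HasSub.used {t : Tm} (h : HasSub r t) {z : ℕ} (hz : Used z r) : Used z t :=
  hz.imp (fun h' => h'.trans_le (h.varOcc_le z)) (fun h' => h'.trans_le (h.outOcc_le z))

theorem HasSub.sizeOf_le {t : Tm} (h : HasSub r t) : sizeOf r ≤ sizeOf t := by
  induction t <;> simp only [HasSub] at h <;>
    first
    | (subst h; exact le_rfl)
    | (rcases h with rfl | h
       · exact le_rfl
       · grind [Tm.out.sizeOf_spec, Tm.out2.sizeOf_spec, Tm.par.sizeOf_spec,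
           Tm.close.sizeOf_spec, Tm.app.sizeOf_spec])

theorem repl_eq_subst {x : ℕ} {u t : Tm} (h : ¬ HasSub r t)
    (hσ : ∀ z, 0 < varOcc z t → σ z = if z = x then u else var z) :
    repl r b σ t = subst x u t := by
  induction t <;> simp only [HasSub, not_or] at h <;> grind [repl, subst, varOcc]

theorem subst_eq_self {x : ℕ} {u t : Tm} (h : varOcc x t = 0) : subst x u t = t := by
  induction t <;> grind [subst, varOcc]

theorem repl_eq_self {t : Tm} (h : ¬ HasSub r t) (hσ : ∀ z, 0 < varOcc z t → σ z = var z) :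
    repl r b σ t = t := by
  induction t <;> simp only [HasSub, not_or] at h <;> grind [repl, varOcc]

theorem repl_var_eq_subst (x : ℕ) (u t : Tm) : repl (var x) u var t = subst x u t := by
  induction t <;> simp_all [repl, subst]

theorem used_repl {z : ℕ} {P : Prop} (hb : Used z b → P)
    (hσ : ∀ w, Used z (σ w) → z = w ∨ P) {t : Tm} (h : Used z (repl r b σ t)) :
    Used z t ∨ P := by
  induction t with
  | var y =>
    by_cases hr : var y = r
    · rw [repl, if_pos hr] at h; exact Or.inr (hb h)
    · rw [repl, if_neg hr] at h
      rcases hσ y h with rfl | h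
      · simp [Used, varOcc]
      · exact Or.inr h
  | _ =>
    rw [repl] at h
    split_ifs at h <;> grind [Used, varOcc, outOcc]

theorem used_out {z x : ℕ} {t : Tm} : Used z (out x t) ↔ x = z ∨ Used z t := by
  grind [Used, varOcc, outOcc]

theorem used_out2 {z x y : ℕ} {t : Tm} : Used z (out2 x y t) ↔ x = z ∨ y = z ∨ Used z t := by
  grind [Used, varOcc, outOcc]

theorem used_par {z : ℕ} {s t : Tm} : Used z (par s t) ↔ Used z s ∨ Used z t := by
  grind [Used, varOcc, outOcc]

theorem used_app {z : ℕ} {s t : Tm} : Used z (app s t) ↔ Used z s ∨ Used z t := by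
  grind [Used, varOcc, outOcc]

theorem used_close {z : ℕ} {t : Tm} : Used z (close t) ↔ Used z t := Iff.rfl

theorem used_var {z x : ℕ} : Used z (var x) ↔ x = z := by
  grind [Used, varOcc, outOcc]

theorem not_used_unit {z : ℕ} : ¬ Used z unit := by
  simp [Used, varOcc, outOcc]

end Tm

open Tm

/-- z is declared in Γ -/
def InCtx (Γ : Multiset (ℕ × Ty)) (z : ℕ) : Prop := ∃ A, (z, A) ∈ Γ

/-- z occurs in a term of Δ -/
def InRhs (Δ : Multiset Entry) (z : ℕ) : Prop := ∃ e ∈ Δ, Used z e.1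

theorem usedIn_iff {Γ : Multiset (ℕ × Ty)} {Δ : Multiset Entry} {z : ℕ} :
    UsedIn Γ Δ z ↔ InCtx Γ z ∨ InRhs Δ z := Iff.rfl

@[simp] theorem inCtx_zero {z : ℕ} : ¬ InCtx 0 z := by simp [InCtx]

@[simp] theorem inCtx_cons {p : ℕ × Ty} {Γ : Multiset (ℕ × Ty)} {z : ℕ} :
    InCtx (p ::ₘ Γ) z ↔ p.1 = z ∨ InCtx Γ z := by
  rcases p with ⟨x, A⟩
  simp only [InCtx, Multiset.mem_cons, Prod.mk.injEq, exists_or]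
  exact or_congr ⟨fun ⟨_, h, _⟩ => h.symm, fun h => ⟨A, h.symm, rfl⟩⟩ Iff.rfl

@[simp] theorem inCtx_singleton {p : ℕ × Ty} {z : ℕ} : InCtx {p} z ↔ p.1 = z := by
  rw [← Multiset.cons_zero, inCtx_cons]; simp

@[simp] theorem inCtx_add {Γ Φ : Multiset (ℕ × Ty)} {z : ℕ} :
    InCtx (Γ + Φ) z ↔ InCtx Γ z ∨ InCtx Φ z := by
  simp [InCtx, exists_or]

@[simp] theorem inRhs_zero {z : ℕ} : ¬ InRhs 0 z := by simp [InRhs]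

@[simp] theorem inRhs_cons {e : Entry} {Δ : Multiset Entry} {z : ℕ} :
    InRhs (e ::ₘ Δ) z ↔ Used z e.1 ∨ InRhs Δ z := by
  simp [InRhs]

@[simp] theorem inRhs_singleton {e : Entry} {z : ℕ} : InRhs {e} z ↔ Used z e.1 := by
  simp [InRhs]

@[simp] theorem inRhs_add {Δ Θ : Multiset Entry} {z : ℕ} :
    InRhs (Δ + Θ) z ↔ InRhs Δ z ∨ InRhs Θ z := by
  simp [InRhs, or_and_right, exists_or]

theorem varOccM_pos {Δ : Multiset Entry} {z : ℕ} (h : 0 < varOccM z Δ) : InRhs Δ z := by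
  contrapose! h
  simp only [InRhs, Used] at h
  simp only [varOccM, Nat.le_zero, Multiset.sum_eq_zero_iff, Multiset.mem_map]
  rintro _ ⟨e, he, rfl⟩
  by_contra h'
  exact h ⟨e, he, Or.inl (Nat.pos_of_ne_zero h')⟩

@[simp] theorem varOccM_cons (z : ℕ) (e : Entry) (Δ : Multiset Entry) :
    varOccM z (e ::ₘ Δ) = varOcc z e.1 + varOccM z Δ := by simp [varOccM]

@[simp] theorem outOccM_cons (z : ℕ) (e : Entry) (Δ : Multiset Entry) :
    outOccM z (e ::ₘ Δ) = outOcc z e.1 + outOccM z Δ := by simp [outOccM]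

@[simp] theorem varOccM_add (z : ℕ) (Δ Θ : Multiset Entry) :
    varOccM z (Δ + Θ) = varOccM z Δ + varOccM z Θ := by simp [varOccM]

@[simp] theorem outOccM_add (z : ℕ) (Δ Θ : Multiset Entry) :
    outOccM z (Δ + Θ) = outOccM z Δ + outOccM z Θ := by simp [outOccM]

/-- number of declarations of z in Γ -/
def declM (z : ℕ) (Γ : Multiset (ℕ × Ty)) : ℕ :=
  (Γ.map (fun p => if p.1 = z then 1 else 0)).sum

@[simp] theorem declM_cons (z : ℕ) (p : ℕ × Ty) (Γ : Multiset (ℕ × Ty)) :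
    declM z (p ::ₘ Γ) = (if p.1 = z then 1 else 0) + declM z Γ := by simp [declM]

@[simp] theorem declM_add (z : ℕ) (Γ Φ : Multiset (ℕ × Ty)) :
    declM z (Γ + Φ) = declM z Γ + declM z Φ := by simp [declM]

theorem SeqDisj.varOccM_eq_zero {Γ₁ Γ₂ : Multiset (ℕ × Ty)} {Δ₁ Δ₂ : Multiset Entry}
    (h : SeqDisj Γ₁ Δ₁ Γ₂ Δ₂) (z : ℕ) : varOccM z Δ₁ = 0 ∨ varOccM z Δ₂ = 0 := by
  by_contra! hpos
  exact h z ⟨Or.inr (varOccM_pos (Nat.pos_of_ne_zero hpos.1)),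
    Or.inr (varOccM_pos (Nat.pos_of_ne_zero hpos.2))⟩

/-- Linearity: every name has at most one input occurrence in a derivable sequent, and it is
either declared or bound by an output, exactly once. -/
theorem NMLL.linear {Γ : Multiset (ℕ × Ty)} {Δ : Multiset Entry} (d : NMLL Γ Δ) (z : ℕ) :
    declM z Γ + outOccM z Δ = varOccM z Δ ∧ varOccM z Δ ≤ 1 := by
  induction d with
  | ax x A =>
    simp only [declM, outOccM, varOccM, Multiset.map_singleton, Multiset.sum_singleton,
      varOcc, outOcc]
    split_ifs <;> simp
  | limpI x A B t d hx ih =>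
    simp only [declM_cons, outOccM_cons, varOccM_cons, varOcc, outOcc] at ih ⊢
    omega
  | limpE s t A B d1 d2 h ih1 ih2 =>
    have := h.varOccM_eq_zero z
    simp only [declM_add, outOccM_cons, varOccM_cons, outOccM_add, varOccM_add, varOcc,
      outOcc] at *
    omega
  | parrI s t A B d ih =>
    simp only [outOccM_cons, varOccM_cons, varOcc, outOcc] at ih ⊢
    omega
  | parrE s x y A B d1 d2 d3 h12 h13 h23 ih1 ih2 ih3 =>
    have h1 := h12.varOccM_eq_zero z
    have h2 := h13.varOccM_eq_zero z
    have h3 := h23.varOccM_eq_zero z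
    simp only [declM_add, declM_cons, outOccM_cons, varOccM_cons, outOccM_add, varOccM_add,
      varOcc, outOcc] at *
    omega
  | botI d ih => simpa [varOcc, outOcc] using ih
  | botE t d ih => simpa [varOcc, outOcc] using ih

/-- ⊸I; its side condition is a consequence of linearity. -/
theorem NMLL.limpI_of {Γ : Multiset (ℕ × Ty)} {Δ : Multiset Entry} {x : ℕ} {A B : Ty} {t : Tm}
    (d : Nonempty (NMLL ((x, A) ::ₘ Γ) ((t, some B) ::ₘ Δ))) :
    Nonempty (NMLL Γ ((Tm.out x t, some (Ty.limp A B)) ::ₘ Δ)) := by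
  obtain ⟨d⟩ := d
  refine ⟨.limpI x A B t d ?_⟩
  by_contra! h
  have hl := (d.linear x).1
  have h0 : varOccM x Δ = 0 := by
    simp only [varOccM, Multiset.sum_eq_zero_iff, Multiset.mem_map]
    rintro _ ⟨e, he, rfl⟩
    exact Nat.le_zero.mp (h.2 e he)
  simp only [declM_cons, if_true, varOccM_cons] at hl
  omega

theorem NMLL.cast {Γ Γ' : Multiset (ℕ × Ty)} {Δ Δ' : Multiset Entry} (d : NMLL Γ Δ)
    (hΓ : Γ = Γ') (hΔ : Δ = Δ') : Nonempty (NMLL Γ' Δ') := by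
  subst hΓ hΔ; exact ⟨d⟩

set_option maxHeartbeats 1000000 in
/-- An entry of a derivable sequent introduced only by ⊸I or ⅋I can be replaced by the
corresponding part of the premise. -/
theorem NMLL.invert {e : Entry} {E : Multiset Entry} {K : Multiset (ℕ × Ty)}
    (hE : ∀ z, InCtx K z ∨ InRhs E z → Used z e.1)
    (hval : e.1.IsValue)
    (hout : ∀ x t A B, e = (Tm.out x t, some (Ty.limp A B)) → ∀ Γ Δ,
      NMLL ((x, A) ::ₘ Γ) ((t, some B) ::ₘ Δ) → Nonempty (NMLL (K + Γ) (E + Δ)))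
    (hpar : ∀ s t A B, e = (Tm.par s t, some (Ty.parr A B)) → ∀ Γ Δ,
      NMLL Γ ((s, some A) ::ₘ (t, some B) ::ₘ Δ) → Nonempty (NMLL (K + Γ) (E + Δ)))
    {Γ : Multiset (ℕ × Ty)} {Δ' : Multiset Entry} (d : NMLL Γ Δ') :
    ∀ Δ, Δ' = e ::ₘ Δ → Nonempty (NMLL (K + Γ) (E + Δ)) := by
  have hmem : ∀ {Δ₁ : Multiset Entry}, e ∈ Δ₁ → ∃ Δ₂, Δ₁ = e ::ₘ Δ₂ :=
    fun h => Multiset.exists_cons_of_mem h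
  induction d with
  | ax x A =>
    intro Δ h
    have : e = (Tm.var x, some A) := by
      have : e ∈ ({(Tm.var x, some A)} : Multiset Entry) := by rw [h]; simp
      simpa using this
    subst this
    exact hval.elim
  | @limpI Γ Δ₀ x A B t d hx ih =>
    intro Δ h
    rcases Multiset.cons_eq_cons.mp h with ⟨he, rfl⟩ | ⟨_, cs, rfl, rfl⟩
    · exact hout x t A B he.symm _ _ d
    · obtain ⟨d'⟩ := ih _ (Multiset.cons_swap _ _ _)
      obtain ⟨d''⟩ := d'.cast (Multiset.add_cons _ _ _) (Multiset.add_cons _ _ _)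
      exact Multiset.add_cons _ _ _ ▸ limpI_of ⟨d''⟩
  | @limpE Γ Φ Δ₁ Θ s t A B d1 d2 hd ih1 ih2 =>
    intro Δ h
    rcases Multiset.cons_eq_cons.mp h with ⟨rfl, rfl⟩ | ⟨_, cs, hcs, rfl⟩
    · exact hval.elim
    rcases Multiset.mem_add.mp (hcs ▸ Multiset.mem_cons_self e cs) with hm | hm
    · obtain ⟨Δ₂, rfl⟩ := hmem hm
      rw [Multiset.cons_add, Multiset.cons_inj_right] at hcs
      subst hcs
      obtain ⟨d'⟩ := ih1 _ (Multiset.cons_swap _ _ _)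
      obtain ⟨d''⟩ := d'.cast rfl (Multiset.add_cons _ _ _)
      refine (NMLL.limpE _ _ _ _ d'' d2 ?_).cast ?_ ?_
      · intro z
        have := hd z
        have := hE z
        simp only [usedIn_iff, inCtx_add, inRhs_add, inRhs_cons] at *
        tauto
      · abel
      · simp only [← Multiset.singleton_add]; abel
    · obtain ⟨Δ₂, rfl⟩ := hmem hm
      rw [Multiset.add_cons, Multiset.cons_inj_right] at hcs
      subst hcs
      obtain ⟨d'⟩ := ih2 _ (Multiset.cons_swap _ _ _)
      obtain ⟨d''⟩ := d'.cast rfl (Multiset.add_cons _ _ _)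
      refine (NMLL.limpE _ _ _ _ d1 d'' ?_).cast ?_ ?_
      · intro z
        have := hd z
        have := hE z
        simp only [usedIn_iff, inCtx_add, inRhs_add, inRhs_cons] at *
        tauto
      · abel
      · simp only [← Multiset.singleton_add]; abel
  | @parrI Γ Δ₀ s t A B d ih =>
    intro Δ h
    rcases Multiset.cons_eq_cons.mp h with ⟨he, rfl⟩ | ⟨_, cs, rfl, rfl⟩
    · exact hpar s t A B he.symm _ _ d
    · obtain ⟨d'⟩ := ih ((s, some A) ::ₘ (t, some B) ::ₘ cs)
        (by simp only [← Multiset.singleton_add]; abel)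
      obtain ⟨d''⟩ := d'.cast rfl (Δ' := (s, some A) ::ₘ (t, some B) ::ₘ (E + cs))
        (by simp only [← Multiset.singleton_add]; abel)
      exact (NMLL.parrI _ _ _ _ d'').cast rfl (Multiset.add_cons _ _ _).symm
  | @parrE Γ Φ₁ Φ₂ Δ₁ Θ₁ Θ₂ s x y A B d1 d2 d3 h12 h13 h23 ih1 ih2 ih3 =>
    intro Δ h
    rcases Multiset.cons_eq_cons.mp h with ⟨rfl, rfl⟩ | ⟨_, cs, hcs, rfl⟩
    · exact hval.elim
    have hm := hcs ▸ Multiset.mem_cons_self e cs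
    simp only [Multiset.mem_add] at hm
    rcases hm with (hm | hm) | hm
    · obtain ⟨Δ₂, rfl⟩ := hmem hm
      rw [Multiset.cons_add, Multiset.cons_add, Multiset.cons_inj_right] at hcs
      subst hcs
      obtain ⟨d'⟩ := ih1 _ (Multiset.cons_swap _ _ _)
      obtain ⟨d''⟩ := d'.cast rfl (Multiset.add_cons _ _ _)
      refine (NMLL.parrE _ _ _ _ _ d'' d2 d3 ?_ ?_ h23).cast ?_ ?_
      · intro z
        have := h12 z
        have := hE z
        simp only [usedIn_iff, inCtx_add, inRhs_add, inRhs_cons] at *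
        tauto
      · intro z
        have := h13 z
        have := hE z
        simp only [usedIn_iff, inCtx_add, inRhs_add, inRhs_cons] at *
        tauto
      · abel
      · simp only [← Multiset.singleton_add]; abel
    · obtain ⟨Δ₂, rfl⟩ := hmem hm
      rw [Multiset.add_cons, Multiset.cons_add, Multiset.cons_inj_right] at hcs
      subst hcs
      obtain ⟨d'⟩ := ih2 _ rfl
      obtain ⟨d''⟩ := d'.cast (Multiset.add_cons _ _ _) rfl
      refine (NMLL.parrE _ _ _ _ _ d1 d'' d3 ?_ h13 ?_).cast ?_ ?_
      · intro z
        have := h12 z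
        have := hE z
        simp only [usedIn_iff, inCtx_add, inCtx_cons, inRhs_add, inRhs_cons] at *
        tauto
      · intro z
        have := h23 z
        have := hE z
        simp only [usedIn_iff, inCtx_add, inCtx_cons, inRhs_add, inRhs_cons] at *
        tauto
      · abel
      · simp only [← Multiset.singleton_add]; abel
    · obtain ⟨Δ₂, rfl⟩ := hmem hm
      rw [Multiset.add_cons, Multiset.cons_inj_right] at hcs
      subst hcs
      obtain ⟨d'⟩ := ih3 _ rfl
      obtain ⟨d''⟩ := d'.cast (Multiset.add_cons _ _ _) rfl
      refine (NMLL.parrE _ _ _ _ _ d1 d2 d'' h12 ?_ ?_).cast ?_ ?_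
      · intro z
        have := h13 z
        have := hE z
        simp only [usedIn_iff, inCtx_add, inCtx_cons, inRhs_add, inRhs_cons] at *
        tauto
      · intro z
        have := h23 z
        have := hE z
        simp only [usedIn_iff, inCtx_add, inCtx_cons, inRhs_add, inRhs_cons] at *
        tauto
      · abel
      · simp only [← Multiset.singleton_add]; abel
  | @botI Γ Δ₀ d ih =>
    intro Δ h
    rcases Multiset.cons_eq_cons.mp h with ⟨rfl, rfl⟩ | ⟨_, cs, rfl, rfl⟩
    · exact hval.elim
    · obtain ⟨d'⟩ := ih _ rfl
      exact (NMLL.botI d').cast rfl (Multiset.add_cons _ _ _).symm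
  | @botE Γ Δ₀ t d ih =>
    intro Δ h
    rcases Multiset.cons_eq_cons.mp h with ⟨rfl, rfl⟩ | ⟨_, cs, rfl, rfl⟩
    · exact hval.elim
    · obtain ⟨d'⟩ := ih _ (Multiset.cons_swap _ _ _)
      obtain ⟨d''⟩ := d'.cast rfl (Multiset.add_cons _ _ _)
      exact (NMLL.botE _ d'').cast rfl (Multiset.add_cons _ _ _).symm

theorem NMLL.invert_out {Γ : Multiset (ℕ × Ty)} {Δ : Multiset Entry} {x : ℕ} {s : Tm} {A B : Ty}
    (d : NMLL Γ ((Tm.out x s, some (Ty.limp A B)) ::ₘ Δ)) :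
    Nonempty (NMLL ((x, A) ::ₘ Γ) ((s, some B) ::ₘ Δ)) := by
  rw [← Multiset.singleton_add, ← Multiset.singleton_add (s, some B)]
  refine NMLL.invert (e := (Tm.out x s, some (Ty.limp A B))) ?_ trivial ?_ ?_ d Δ rfl
  · intro z
    simp [used_out]
  · rintro x t A B h Γ Δ d
    cases h
    exact ⟨d⟩
  · rintro _ _ _ _ h
    cases h

theorem NMLL.invert_par {Γ : Multiset (ℕ × Ty)} {Δ : Multiset Entry} {s t : Tm} {A B : Ty}
    (d : NMLL Γ ((Tm.par s t, some (Ty.parr A B)) ::ₘ Δ)) :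
    Nonempty (NMLL Γ ((s, some A) ::ₘ (t, some B) ::ₘ Δ)) := by
  have := NMLL.invert (e := (Tm.par s t, some (Ty.parr A B))) (K := 0)
    (E := (s, some A) ::ₘ (t, some B) ::ₘ 0) ?_ trivial ?_ ?_ d Δ rfl
  · simpa using this
  · intro z
    simp [used_par]
  · rintro _ _ _ _ h
    cases h
  · rintro s t A B h Γ Δ d
    cases h
    exact d.cast (zero_add _).symm (by simp)

/-- apply `Tm.repl` to the term of an entry -/
def replEntry (r b : Tm) (σ : ℕ → Tm) (e : Entry) : Entry := (repl r b σ e.1, e.2)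

theorem SeqDisj.symm {Γ₁ Γ₂ : Multiset (ℕ × Ty)} {Δ₁ Δ₂ : Multiset Entry}
    (h : SeqDisj Γ₁ Δ₁ Γ₂ Δ₂) : SeqDisj Γ₂ Δ₂ Γ₁ Δ₁ := fun z hz => h z hz.symm

theorem Multiset.exists_eq_add_of_add_eq_add {α : Type*} [DecidableEq α] {K Γ Γ₁ Γ₂ : Multiset α}
    (h : Γ₁ + Γ₂ = K + Γ) (hK : ∀ p ∈ K, p ∉ Γ₂) : ∃ Γ', Γ₁ = K + Γ' ∧ Γ = Γ' + Γ₂ := by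
  have hle : K ≤ Γ₁ := by
    rw [Multiset.le_iff_count]
    intro a
    by_cases ha : a ∈ K
    · have h' := congrArg (Multiset.count a) h
      simp only [Multiset.count_add, Multiset.count_eq_zero_of_notMem (hK a ha)] at h'
      omega
    · simp [Multiset.count_eq_zero_of_notMem ha]
  obtain ⟨Γ', rfl⟩ := Multiset.le_iff_exists_add.mp hle
  exact ⟨Γ', rfl, (add_left_cancel (by rw [← h, add_assoc])).symm⟩

set_option maxHeartbeats 1000000 in
/-- Replacement of a subterm r inside a derivation, together with the variables moved by σ: the
declarations K are exchanged for Φ and the entries Θ are added, provided this is possible at the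
inference that introduces r. -/
theorem NMLL.replace {r b : Tm} {σ : ℕ → Tm} {K Φ : Multiset (ℕ × Ty)} {Θ : Multiset Entry}
    {W : ℕ → Prop}
    (hne : ∃ z, Used z r)
    (hK : ∀ z, InCtx K z → Used z r)
    (hσr : ∀ z, σ z ≠ Tm.var z → Used z r)
    (hb : ∀ z, Used z b → Used z r ∨ W z)
    (hσ : ∀ z w, Used z (σ w) → z = w ∨ Used z r ∨ W z)
    (hΦ : ∀ z, InCtx Φ z ∨ InRhs Θ z → W z)
    (hval : ¬ r.IsValue) (hunit : r ≠ Tm.unit) (hclose : ∀ t, r ≠ Tm.close t)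
    (hax : ∀ x A Γ, r = Tm.var x → {(x, A)} = K + Γ →
      Nonempty (NMLL (Φ + Γ) ((b, some A) ::ₘ Θ)))
    (happ : ∀ s t A B Γ₁ Γ₂ Δ₁ Δ₂ Γ, r = Tm.app s t →
      NMLL Γ₁ ((s, some (Ty.limp A B)) ::ₘ Δ₁) → NMLL Γ₂ ((t, some A) ::ₘ Δ₂) →
      SeqDisj Γ₁ ((s, some (Ty.limp A B)) ::ₘ Δ₁) Γ₂ ((t, some A) ::ₘ Δ₂) →
      Γ₁ + Γ₂ = K + Γ →
      Nonempty (NMLL (Φ + Γ) ((b, some B) ::ₘ ((Δ₁ + Δ₂).map (replEntry r b σ) + Θ))))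
    (hout2 : ∀ s x y A B Γ₁ Γ₂ Γ₃ Δ₁ Δ₂ Δ₃ Γ, r = Tm.out2 x y s →
      NMLL Γ₁ ((s, some (Ty.parr A B)) ::ₘ Δ₁) →
      NMLL ((x, A) ::ₘ Γ₂) Δ₂ → NMLL ((y, B) ::ₘ Γ₃) Δ₃ →
      SeqDisj Γ₁ ((s, some (Ty.parr A B)) ::ₘ Δ₁) ((x, A) ::ₘ Γ₂) Δ₂ →
      SeqDisj Γ₁ ((s, some (Ty.parr A B)) ::ₘ Δ₁) ((y, B) ::ₘ Γ₃) Δ₃ →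
      SeqDisj ((x, A) ::ₘ Γ₂) Δ₂ ((y, B) ::ₘ Γ₃) Δ₃ →
      Γ₁ + Γ₂ + Γ₃ = K + Γ →
      Nonempty (NMLL (Φ + Γ)
        ((b, some Ty.bot) ::ₘ ((Δ₁ + Δ₂ + Δ₃).map (replEntry r b σ) + Θ))))
    {Γ' : Multiset (ℕ × Ty)} {Δ : Multiset Entry} (d : NMLL Γ' Δ) :
    ∀ Γ, Γ' = K + Γ → (∀ z, W z → ¬ (InCtx Γ' z ∨ InRhs Δ z)) →
      (∃ e ∈ Δ, HasSub r e.1) →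
      Nonempty (NMLL (Φ + Γ) (Δ.map (replEntry r b σ) + Θ)) := by
  have hrhs : ∀ (Δ : Multiset Entry) z, InRhs (Δ.map (replEntry r b σ)) z →
      InRhs Δ z ∨ Used z r ∨ W z := by
    rintro Δ z ⟨e, he, hz⟩
    obtain ⟨e', he', rfl⟩ := Multiset.mem_map.mp he
    exact (used_repl (hb z) (hσ z) hz).imp (fun h => ⟨e', he', h⟩) id
  have hsub : ∀ {Δ : Multiset Entry}, (∃ e ∈ Δ, HasSub r e.1) → ∀ z, Used z r → InRhs Δ z :=
    fun ⟨e, he, h⟩ z hz => ⟨e, he, h.used hz⟩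
  have hdisj : ∀ {Γ Δ Φ' Θ'}, SeqDisj (K + Γ) Δ Φ' Θ' → (∃ e ∈ Δ, HasSub r e.1) →
      (∀ z, W z → ¬ (InCtx Φ' z ∨ InRhs Θ' z)) →
      SeqDisj (Φ + Γ) (Δ.map (replEntry r b σ) + Θ) Φ' Θ' := by
    intro Γ Δ Φ' Θ' hd hs hW z
    have h1 := hd z
    have h2 := hW z
    have h3 := hsub hs z
    have h4 := hrhs Δ z
    have h5 := hΦ z
    simp only [usedIn_iff, inCtx_add, inRhs_add] at *
    tauto
  have hid : ∀ {Γ Δ Φ' Θ'}, SeqDisj Γ Δ Φ' Θ' → (∃ e ∈ Δ, HasSub r e.1) →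
      ∀ e ∈ Θ', repl r b σ e.1 = e.1 := by
    intro Γ Δ Φ' Θ' hd hs e he
    have h : ∀ z, Used z r → ¬ Used z e.1 := fun z hz hz' =>
      hd z ⟨Or.inr (hsub hs z hz), Or.inr ⟨e, he, hz'⟩⟩
    obtain ⟨z, hz⟩ := hne
    refine repl_eq_self (fun hr => h z hz (hr.used hz)) fun w hw => ?_
    by_contra hw'
    exact h w (hσr w hw') (Or.inl hw)
  have hmap : ∀ {Θ' : Multiset Entry}, (∀ e ∈ Θ', repl r b σ e.1 = e.1) →
      Θ'.map (replEntry r b σ) = Θ' := by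
    intro Θ' h
    exact (Multiset.map_congr rfl fun e he =>
      show replEntry r b σ e = id e from Prod.ext (h e he) rfl).trans (Multiset.map_id _)
  have hsplit : ∀ {Γ₁ Γ₂ Γ Δ₁}, Γ₁ + Γ₂ = K + Γ → (∀ z, InRhs Δ₁ z → ¬ InCtx Γ₂ z) →
      (∃ e ∈ Δ₁, HasSub r e.1) → ∃ Γ', Γ₁ = K + Γ' ∧ Γ = Γ' + Γ₂ :=
    fun h hd hs => Multiset.exists_eq_add_of_add_eq_add h fun p hp hp' =>
      hd p.1 (hsub hs _ (hK _ ⟨p.2, hp⟩)) ⟨p.2, hp'⟩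
  induction d with
  | ax x A =>
    rintro Γ hΓ hW ⟨e, he, hs⟩
    obtain rfl := Multiset.mem_singleton.mp he
    have hr : Tm.var x = r := hs
    simpa [replEntry, hr, repl_self] using hax x A Γ hr.symm hΓ
  | @limpI Γ₀ Δ x A B t d hx ih =>
    rintro Γ rfl hW hs
    have hr : Tm.out x t ≠ r := fun h => hval (h ▸ trivial)
    have hs' : ∃ e ∈ (t, some B) ::ₘ Δ, HasSub r e.1 := by
      simpa [HasSub, hr] using hs
    obtain ⟨d'⟩ := ih ((x, A) ::ₘ Γ) (Multiset.add_cons _ _ _).symm (by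
      intro z hz
      have := hW z hz
      simp only [inCtx_cons, inRhs_cons, used_out] at *
      tauto) hs'
    rw [Multiset.map_cons, Multiset.cons_add, Multiset.add_cons] at d'
    have := NMLL.limpI_of ⟨d'⟩
    simpa [replEntry, repl, hr] using this
  | @limpE Γ₁ Γ₂ Δ₁ Δ₂ s t A B d1 d2 hd ih1 ih2 =>
    rintro Γ hΓ hW hs
    by_cases hr : Tm.app s t = r
    · simpa [replEntry, hr, repl_self] using happ s t A B Γ₁ Γ₂ Δ₁ Δ₂ Γ hr.symm d1 d2 hd hΓ
    have hW1 : ∀ z, W z → ¬ (InCtx Γ₁ z ∨ InRhs ((s, some (Ty.limp A B)) ::ₘ Δ₁) z) := by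
      intro z hz
      have := hW z hz
      simp only [inCtx_add, inRhs_add, inRhs_cons, used_app] at *
      tauto
    have hW2 : ∀ z, W z → ¬ (InCtx Γ₂ z ∨ InRhs ((t, some A) ::ₘ Δ₂) z) := by
      intro z hz
      have := hW z hz
      simp only [inCtx_add, inRhs_add, inRhs_cons, used_app] at *
      tauto
    have hs' : (∃ e ∈ (s, some (Ty.limp A B)) ::ₘ Δ₁, HasSub r e.1) ∨
        ∃ e ∈ (t, some A) ::ₘ Δ₂, HasSub r e.1 := by
      simp only [Multiset.mem_cons, Multiset.mem_add, HasSub, hr, false_or, or_and_right,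
        exists_or, exists_eq_left] at hs ⊢
      rcases hs with (hs | hs) | hs | hs
      exacts [Or.inl (Or.inl hs), Or.inr (Or.inl hs), Or.inl (Or.inr hs), Or.inr (Or.inr hs)]
    rcases hs' with hs' | hs'
    · obtain ⟨Γ', rfl, rfl⟩ := hsplit hΓ (fun z hz hz' => hd z ⟨Or.inr hz, Or.inl hz'⟩) hs'
      obtain ⟨d'⟩ := ih1 Γ' rfl hW1 hs'
      have hd' := hdisj hd hs' hW2
      have hfix := hid hd hs'
      rw [Multiset.map_cons, Multiset.cons_add] at d' hd'
      refine (NMLL.limpE _ _ _ _ d' d2 hd').cast (add_assoc _ _ _) ?_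
      rw [Multiset.map_cons, Multiset.map_add,
        hmap fun e he => hfix e (Multiset.mem_cons_of_mem he)]
      simp only [replEntry, repl, if_neg hr, hfix _ (Multiset.mem_cons_self _ _),
        ← Multiset.singleton_add]
      abel
    · rw [add_comm] at hΓ
      obtain ⟨Γ', rfl, rfl⟩ := hsplit hΓ (fun z hz hz' => hd z ⟨Or.inl hz', Or.inr hz⟩) hs'
      obtain ⟨d'⟩ := ih2 Γ' rfl hW2 hs'
      have hd' := hdisj hd.symm hs' hW1
      have hfix := hid hd.symm hs'
      rw [Multiset.map_cons, Multiset.cons_add] at d' hd'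
      refine (NMLL.limpE _ _ _ _ d1 d' hd'.symm).cast (by abel) ?_
      rw [Multiset.map_cons, Multiset.map_add,
        hmap fun e he => hfix e (Multiset.mem_cons_of_mem he)]
      have := hfix _ (Multiset.mem_cons_self _ _)
      simp only at this
      simp only [replEntry, repl, if_neg hr, this, ← Multiset.singleton_add]
      abel
  | @parrI Γ₀ Δ s t A B d ih =>
    rintro Γ rfl hW hs
    have hr : Tm.par s t ≠ r := fun h => hval (h ▸ trivial)
    have hs' : ∃ e ∈ (s, some A) ::ₘ (t, some B) ::ₘ Δ, HasSub r e.1 := by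
      simpa [HasSub, hr, or_assoc] using hs
    obtain ⟨d'⟩ := ih Γ rfl (by
      intro z hz
      have := hW z hz
      simp only [inRhs_cons, used_par] at *
      tauto) hs'
    rw [Multiset.map_cons, Multiset.map_cons, Multiset.cons_add, Multiset.cons_add] at d'
    refine (NMLL.parrI _ _ _ _ d').cast rfl ?_
    simp [replEntry, repl, hr]
  | @parrE Γ₁ Γ₂ Γ₃ Δ₁ Δ₂ Δ₃ s x y A B d1 d2 d3 h12 h13 h23 ih1 ih2 ih3 =>
    rintro Γ hΓ hW hs
    by_cases hr : Tm.out2 x y s = r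
    · simpa [replEntry, hr, repl_self] using hout2 s x y A B Γ₁ Γ₂ Γ₃ Δ₁ Δ₂ Δ₃ Γ hr.symm d1 d2 d3
        h12 h13 h23 hΓ
    have hW1 : ∀ z, W z → ¬ (InCtx Γ₁ z ∨ InRhs ((s, some (Ty.parr A B)) ::ₘ Δ₁) z) := by
      intro z hz
      have := hW z hz
      simp only [inCtx_add, inRhs_add, inRhs_cons, used_out2] at *
      tauto
    have hW2 : ∀ z, W z → ¬ (InCtx ((x, A) ::ₘ Γ₂) z ∨ InRhs Δ₂ z) := by
      intro z hz
      have := hW z hz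
      simp only [inCtx_add, inCtx_cons, inRhs_add, inRhs_cons, used_out2] at *
      tauto
    have hW3 : ∀ z, W z → ¬ (InCtx ((y, B) ::ₘ Γ₃) z ∨ InRhs Δ₃ z) := by
      intro z hz
      have := hW z hz
      simp only [inCtx_add, inCtx_cons, inRhs_add, inRhs_cons, used_out2] at *
      tauto
    have hs' : (∃ e ∈ (s, some (Ty.parr A B)) ::ₘ Δ₁, HasSub r e.1) ∨
        (∃ e ∈ Δ₂, HasSub r e.1) ∨ ∃ e ∈ Δ₃, HasSub r e.1 := by
      simp only [Multiset.mem_cons, Multiset.mem_add, HasSub, hr, false_or, or_and_right,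
        exists_or, exists_eq_left] at hs ⊢
      rcases hs with hs | (hs | hs) | hs
      exacts [Or.inl (Or.inl hs), Or.inl (Or.inr hs), Or.inr (Or.inl hs), Or.inr (Or.inr hs)]
    rcases hs' with hs' | hs' | hs'
    · rw [add_assoc] at hΓ
      obtain ⟨Γ', rfl, rfl⟩ := hsplit hΓ (fun z hz hz' => by
        have h1 := h12 z
        have h2 := h13 z
        simp only [usedIn_iff, inCtx_add, inCtx_cons] at *
        tauto) hs'
      obtain ⟨d'⟩ := ih1 Γ' rfl hW1 hs'
      have hd2 := hdisj h12 hs' hW2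
      have hd3 := hdisj h13 hs' hW3
      rw [Multiset.map_cons, Multiset.cons_add] at d' hd2 hd3
      refine (NMLL.parrE _ _ _ _ _ d' d2 d3 hd2 hd3 h23).cast (by abel) ?_
      rw [Multiset.map_cons, Multiset.map_add, Multiset.map_add, hmap (hid h12 hs'),
        hmap (hid h13 hs')]
      simp only [replEntry, repl, if_neg hr, ← Multiset.singleton_add]
      abel
    · have hΓ' : Γ₂ + (Γ₁ + Γ₃) = K + Γ := by rw [← hΓ]; abel
      obtain ⟨Γ', rfl, rfl⟩ := hsplit hΓ' (fun z hz hz' => by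
        have h1 := h12 z
        have h2 := h23 z
        simp only [usedIn_iff, inCtx_add, inCtx_cons] at *
        tauto) hs'
      rw [← Multiset.add_cons] at h12 h23
      obtain ⟨d'⟩ := ih2 _ (Multiset.add_cons _ _ _).symm hW2 hs'
      have hd1 := hdisj h12.symm hs' hW1
      have hd3 := hdisj h23 hs' hW3
      rw [Multiset.add_cons] at d' hd1 hd3
      refine (NMLL.parrE _ _ _ _ _ d1 d' d3 hd1.symm h13 hd3).cast (by abel) ?_
      have hfix := hid h12.symm hs'
      have := hfix _ (Multiset.mem_cons_self _ _)
      simp only at this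
      rw [Multiset.map_cons, Multiset.map_add, Multiset.map_add,
        hmap fun e he => hfix e (Multiset.mem_cons_of_mem he), hmap (hid h23 hs')]
      simp only [replEntry, repl, if_neg hr, this, ← Multiset.singleton_add]
      abel
    · have hΓ' : Γ₃ + (Γ₁ + Γ₂) = K + Γ := by rw [← hΓ]; abel
      obtain ⟨Γ', rfl, rfl⟩ := hsplit hΓ' (fun z hz hz' => by
        have h1 := h13 z
        have h2 := h23 z
        simp only [usedIn_iff, inCtx_add, inCtx_cons] at *
        tauto) hs'
      rw [← Multiset.add_cons] at h13 h23
      obtain ⟨d'⟩ := ih3 _ (Multiset.add_cons _ _ _).symm hW3 hs'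
      have hd1 := hdisj h13.symm hs' hW1
      have hd2 := hdisj h23.symm hs' hW2
      rw [Multiset.add_cons] at d' hd1 hd2
      refine (NMLL.parrE _ _ _ _ _ d1 d2 d' h12 hd1.symm hd2.symm).cast (by abel) ?_
      have hfix := hid h13.symm hs'
      have := hfix _ (Multiset.mem_cons_self _ _)
      simp only at this
      rw [Multiset.map_cons, Multiset.map_add, Multiset.map_add,
        hmap fun e he => hfix e (Multiset.mem_cons_of_mem he), hmap (hid h23.symm hs')]
      simp only [replEntry, repl, if_neg hr, this, ← Multiset.singleton_add]
      abel
  | @botI Γ₀ Δ d ih =>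
    rintro Γ rfl hW hs
    obtain ⟨d'⟩ := ih Γ rfl (fun z hz => by
      have := hW z hz
      simp only [inRhs_cons] at *
      tauto) (by simpa [HasSub, hunit.symm] using hs)
    refine (NMLL.botI d').cast rfl ?_
    simp [replEntry, repl, hunit.symm]
  | @botE Γ₀ Δ t d ih =>
    rintro Γ rfl hW hs
    obtain ⟨d'⟩ := ih Γ rfl (by simpa [used_close] using hW) (by simpa [HasSub, (hclose t).symm] using hs)
    rw [Multiset.map_cons, Multiset.cons_add] at d'
    refine (NMLL.botE _ d').cast rfl ?_
    simp [replEntry, repl, (hclose t).symm]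

theorem exists_varOcc_pos {Δ : Multiset Entry} {z : ℕ} (h : 0 < varOccM z Δ) :
    ∃ e ∈ Δ, 0 < varOcc z e.1 := by
  by_contra! h'
  refine h.ne' (Multiset.sum_eq_zero fun n hn => ?_)
  obtain ⟨e, he, rfl⟩ := Multiset.mem_map.mp hn
  exact Nat.le_zero.mp (h' e he)

namespace Tm

theorem hasSub_var {x : ℕ} {t : Tm} (h : 0 < varOcc x t) : HasSub (var x) t := by
  induction t <;> grind [HasSub, varOcc]

theorem used_subst {x z : ℕ} {u t : Tm} (h : Used z (subst x u t)) : Used z t ∨ Used z u := by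
  rw [← repl_var_eq_subst] at h
  exact used_repl id (fun w hw => Or.inl (used_var.mp hw).symm) h

end Tm

/-- apply a substitution to the term of an entry -/
def substEntry (x : ℕ) (u : Tm) (e : Entry) : Entry := (Tm.subst x u e.1, e.2)

theorem NMLL.subst {Γ Φ : Multiset (ℕ × Ty)} {Δ Θ : Multiset Entry} {x : ℕ} {A : Ty} {u : Tm}
    (d : NMLL ((x, A) ::ₘ Γ) Δ) (d' : NMLL Φ ((u, some A) ::ₘ Θ))
    (h : SeqDisj ((x, A) ::ₘ Γ) Δ Φ ((u, some A) ::ₘ Θ)) :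
    Nonempty (NMLL (Φ + Γ) (Δ.map (substEntry x u) + Θ)) := by
  have hx : ∃ e ∈ Δ, HasSub (Tm.var x) e.1 := by
    have hl := (d.linear x).1
    rw [declM_cons, if_pos rfl] at hl
    obtain ⟨e, he, hz⟩ := exists_varOcc_pos (Δ := Δ) (z := x) (by omega)
    exact ⟨e, he, hasSub_var hz⟩
  have hentry : replEntry (Tm.var x) u Tm.var = substEntry x u := by
    funext e
    simp only [replEntry, substEntry, repl_var_eq_subst]
  rw [← hentry]
  refine NMLL.replace (K := {(x, A)}) (W := fun z => UsedIn Φ ((u, some A) ::ₘ Θ) z)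
    ⟨x, used_var.mpr rfl⟩ ?_ (fun z hz => absurd rfl hz) ?_ ?_ ?_ id (by simp) (by simp)
    ?_ (by simp) (by simp) d Γ (Multiset.singleton_add _ _).symm (fun z hz hz' => h z ⟨hz', hz⟩) hx
  · intro z hz
    exact used_var.mpr (inCtx_singleton.mp hz)
  · intro z hz
    exact Or.inr (Or.inr (inRhs_cons.mpr (Or.inl hz)))
  · intro z w hz
    exact Or.inl (used_var.mp hz).symm
  · rintro z (hz | hz)
    · exact Or.inl hz
    · exact Or.inr (inRhs_cons.mpr (Or.inr hz))
  · intro y B Γ' hy hΓ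
    have hΓ' : Γ' = 0 := by
      have := congrArg Multiset.card hΓ
      simpa using this
    subst hΓ'
    rw [add_zero, Multiset.singleton_inj, Prod.mk.injEq] at hΓ
    obtain ⟨rfl, rfl⟩ := hΓ
    exact d'.cast (add_zero _).symm rfl

/-- `Redex r b σ`: contracting the redex r puts b in its place and substitutes the transmitted
terms for the input channels according to σ. -/
inductive Redex : Tm → Tm → (ℕ → Tm) → Prop
  | app (x : ℕ) (s u : Tm) : Redex (Tm.app (Tm.out x s) u) (Tm.subst x u s)
      (fun z => if z = x then u else Tm.var z)
  | out2 (x y : ℕ) (s t : Tm) : Redex (Tm.out2 x y (Tm.par s t)) Tm.unit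
      (fun z => if z = y then t else if z = x then s else Tm.var z)

set_option maxHeartbeats 1000000 in
theorem NMLL.contract {r b : Tm} {σ : ℕ → Tm} (hr : Redex r b σ) {Γ : Multiset (ℕ × Ty)}
    {Δ : Multiset Entry} (d : NMLL Γ Δ) (hs : ∃ e ∈ Δ, HasSub r e.1) :
    Nonempty (NMLL Γ (Δ.map (replEntry r b σ))) := by
  rw [← zero_add Γ, ← add_zero (Δ.map _)]
  cases hr with
  | app x s u =>
    have hx : Used x (Tm.app (Tm.out x s) u) := used_app.mpr (Or.inl (used_out.mpr (Or.inl rfl)))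
    refine NMLL.replace (K := 0) (W := fun _ => False) ⟨x, hx⟩ (by simp) ?_ ?_ ?_ (by simp)
      (by simp [IsValue]) (by simp) (by simp) (by simp) ?_ (by simp) d Γ (zero_add Γ).symm
      (by simp) hs
    · intro z hz
      by_cases h : z = x
      · exact h ▸ hx
      · exact absurd (if_neg h) hz
    · intro z hz
      simp only [used_app, used_out]
      have := used_subst hz
      tauto
    · intro z w hz
      simp only [used_app, used_out]
      split_ifs at hz with h
      · tauto
      · exact Or.inl (used_var.mp hz).symm
    · intro s' u' A B Γ₁ Γ₂ Δ₁ Δ₂ Γ' heq d1 d2 hd hΓ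
      cases heq
      obtain ⟨d1'⟩ := d1.invert_out
      have hd' : SeqDisj ((x, A) ::ₘ Γ₁) ((s, some B) ::ₘ Δ₁) Γ₂ ((u, some A) ::ₘ Δ₂) := by
        intro z
        have := hd z
        simp only [usedIn_iff, inCtx_cons, inRhs_cons, used_out] at *
        tauto
      have hl := d1.linear x
      simp only [outOccM_cons, varOccM_cons, outOcc, if_true, varOcc] at hl
      obtain ⟨d'⟩ := d1'.subst d2 hd'
      refine d'.cast (by rw [zero_add] at hΓ ⊢; rw [← hΓ, add_comm]) ?_
      have h1 : Δ₁.map (replEntry (Tm.app (Tm.out x s) u) (Tm.subst x u s)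
          (fun z => if z = x then u else Tm.var z)) = Δ₁.map (substEntry x u) := by
        refine Multiset.map_congr rfl fun e he => Prod.ext (repl_eq_subst ?_ ?_) rfl
        · intro h
          have h1 := h.outOcc_le x
          have h2 : outOcc x e.1 ≤ outOccM x Δ₁ := Multiset.single_le_sum (by simp) _
            (Multiset.mem_map_of_mem (fun e : Entry => outOcc x e.1) he)
          simp only [outOcc, if_true] at h1
          omega
        · intros; rfl
      have h2 : Δ₂.map (replEntry (Tm.app (Tm.out x s) u) (Tm.subst x u s)
          (fun z => if z = x then u else Tm.var z)) = Δ₂ := by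
        refine (Multiset.map_congr rfl fun e he => ?_).trans (Multiset.map_id _)
        have hxe : ¬ Used x e.1 := fun h => hd x
          ⟨Or.inr (inRhs_cons.mpr (Or.inl (used_out.mpr (Or.inl rfl)))),
            Or.inr (inRhs_cons.mpr (Or.inr ⟨e, he, h⟩))⟩
        refine Prod.ext (repl_eq_self (fun h => hxe (h.used hx)) fun z hz => if_neg ?_) rfl
        rintro rfl
        exact hxe (Or.inl hz)
      rw [Multiset.map_add, h1, h2, add_zero, Multiset.map_cons, Multiset.cons_add]
      rfl
  | out2 x y s t =>
    have hx : Used x (Tm.out2 x y (Tm.par s t)) := used_out2.mpr (Or.inl rfl)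
    have hy : Used y (Tm.out2 x y (Tm.par s t)) := used_out2.mpr (Or.inr (Or.inl rfl))
    refine NMLL.replace (K := 0) (W := fun _ => False) ⟨x, hx⟩ (by simp) ?_ ?_ ?_ (by simp)
      (by simp [IsValue]) (by simp) (by simp) (by simp) (by simp) ?_ d Γ (zero_add Γ).symm
      (by simp) hs
    · intro z hz
      by_cases h : z = y
      · exact h ▸ hy
      · by_cases h' : z = x
        · exact h' ▸ hx
        · simp [h, h'] at hz
    · intro z hz
      exact absurd hz not_used_unit
    · intro z w hz
      simp only [used_out2, used_par]
      split_ifs at hz with h h'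
      · tauto
      · tauto
      · exact Or.inl (used_var.mp hz).symm
    · intro s' x' y' A B Γ₁ Γ₂ Γ₃ Δ₁ Δ₂ Δ₃ Γ' heq d1 d2 d3 h12 h13 h23 hΓ
      cases heq
      obtain ⟨d1'⟩ := d1.invert_par
      have hd2 : SeqDisj ((x, A) ::ₘ Γ₂) Δ₂ Γ₁ ((s, some A) ::ₘ (t, some B) ::ₘ Δ₁) := by
        intro z
        have := h12 z
        simp only [usedIn_iff, inCtx_cons, inRhs_cons, used_par] at *
        tauto
      obtain ⟨d2'⟩ := d2.subst d1' hd2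
      have hsub : ∀ z, InRhs (Δ₂.map (substEntry x s)) z → InRhs Δ₂ z ∨ Used z s := by
        rintro z ⟨e, he, hz⟩
        obtain ⟨e', he', rfl⟩ := Multiset.mem_map.mp he
        exact (used_subst hz).imp (fun h => ⟨e', he', h⟩) id
      rw [Multiset.add_cons] at d2'
      have hd3 : SeqDisj ((y, B) ::ₘ Γ₃) Δ₃ (Γ₁ + Γ₂)
          ((t, some B) ::ₘ (Δ₂.map (substEntry x s) + Δ₁)) := by
        intro z
        have h1 := h13 z
        have h2 := h23 z
        have h3 := hsub z
        simp only [usedIn_iff, inCtx_add, inRhs_add, inCtx_cons, inRhs_cons, used_par] at *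
        tauto
      obtain ⟨d3'⟩ := d3.subst d2' hd3
      refine d3'.botI.cast (by rw [zero_add] at hΓ ⊢; exact hΓ) ?_
      have nx1 : ∀ e ∈ Δ₁, ¬ Used x e.1 := fun e he h => h12 x
        ⟨Or.inr (inRhs_cons.mpr (Or.inr ⟨e, he, h⟩)), Or.inl (inCtx_cons.mpr (Or.inl rfl))⟩
      have ny1 : ∀ e ∈ Δ₁, ¬ Used y e.1 := fun e he h => h13 y
        ⟨Or.inr (inRhs_cons.mpr (Or.inr ⟨e, he, h⟩)), Or.inl (inCtx_cons.mpr (Or.inl rfl))⟩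
      have ny2 : ∀ e ∈ Δ₂, ¬ Used y e.1 := fun e he h => h23 y
        ⟨Or.inr ⟨e, he, h⟩, Or.inl (inCtx_cons.mpr (Or.inl rfl))⟩
      have nx3 : ∀ e ∈ Δ₃, ¬ Used x e.1 := fun e he h => h23 x
        ⟨Or.inl (inCtx_cons.mpr (Or.inl rfl)), Or.inr ⟨e, he, h⟩⟩
      have h1 : Δ₁.map (replEntry (Tm.out2 x y (Tm.par s t)) Tm.unit
          (fun z => if z = y then t else if z = x then s else Tm.var z)) = Δ₁ := by
        refine (Multiset.map_congr rfl fun e he => ?_).trans (Multiset.map_id _)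
        refine Prod.ext (repl_eq_self (fun h => nx1 e he (h.used hx)) fun z hz => ?_) rfl
        rw [if_neg, if_neg]
        · rintro rfl; exact nx1 e he (Or.inl hz)
        · rintro rfl; exact ny1 e he (Or.inl hz)
      have h2 : Δ₂.map (replEntry (Tm.out2 x y (Tm.par s t)) Tm.unit
          (fun z => if z = y then t else if z = x then s else Tm.var z)) =
          Δ₂.map (substEntry x s) := by
        refine Multiset.map_congr rfl fun e he => Prod.ext
          (repl_eq_subst (fun h => ny2 e he (h.used hy)) fun z hz => ?_) rfl
        rw [if_neg]
        rintro rfl; exact ny2 e he (Or.inl hz)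
      have h3 : Δ₃.map (replEntry (Tm.out2 x y (Tm.par s t)) Tm.unit
          (fun z => if z = y then t else if z = x then s else Tm.var z)) =
          Δ₃.map (substEntry y t) := by
        refine Multiset.map_congr rfl fun e he => Prod.ext
          (repl_eq_subst (fun h => nx3 e he (h.used hx)) fun z hz => ?_) rfl
        rw [if_neg (c := z = x)]
        rintro rfl; exact nx3 e he (Or.inl hz)
      rw [Multiset.map_add, Multiset.map_add, h1, h2, h3, add_zero]
      congr 1
      abel

theorem hasSub_fill (C : Ctx) (t : Tm) : HasSub t (C.fill t) := by
  induction C with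
  | hole => exact hasSub_refl t
  | _ => simp_all [Ctx.fill, HasSub]

theorem varOcc_le_fill2 (D : Ctx2) (a b : Tm) (z : ℕ) :
    varOcc z a + varOcc z b ≤ varOcc z (D.fill a b) := by
  induction D with
  | parLR C E | parRL C E | appLR C E | appRL C E =>
    simp only [Ctx2.fill, varOcc]
    have h1 := (hasSub_fill C a).varOcc_le z
    have h2 := (hasSub_fill C b).varOcc_le z
    have h3 := (hasSub_fill E a).varOcc_le z
    have h4 := (hasSub_fill E b).varOcc_le z
    omega
  | _ => simp only [Ctx2.fill, varOcc]; omega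

section Fill

variable {r b : Tm} {σ : ℕ → Tm}

theorem repl_eq_self_of_occ {t : Tm} {w : ℕ} (hw : 0 < outOcc w r) (ht : outOcc w t = 0)
    (hvar : ∀ z, σ z ≠ Tm.var z → varOcc z t = 0) : repl r b σ t = t := by
  refine repl_eq_self (fun h => ?_) fun z hz => ?_
  · have := h.outOcc_le w
    omega
  · by_contra h
    have := hvar z h
    omega

theorem ne_of_hasSub {t n : Tm} (h : HasSub r t ∨ ¬ HasSub r n) (hn : sizeOf t < sizeOf n) :
    n ≠ r := by
  rintro rfl
  rcases h with h | h
  · have := h.sizeOf_le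
    omega
  · exact h (hasSub_refl _)

theorem repl_fill {w : ℕ} (hw : 0 < outOcc w r) (C : Ctx) {t : Tm}
    (hpath : HasSub r t ∨ ¬ HasSub r (C.fill t))
    (hout : outOcc w (C.fill t) ≤ outOcc w t)
    (hvar : ∀ z, σ z ≠ Tm.var z → varOcc z (C.fill t) ≤ varOcc z t) :
    repl r b σ (C.fill t) = C.fill (repl r b σ t) := by
  induction C with
  | hole => rfl
  | out x C ih =>
    have hs := (hasSub_fill C t).sizeOf_le
    have hne := ne_of_hasSub hpath (by simp only [Ctx.fill, Tm.out.sizeOf_spec]; omega)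
    simp only [Ctx.fill, outOcc, varOcc, HasSub] at *
    rw [repl, if_neg hne, ih (by tauto) (by omega) hvar]
  | out2 x y C ih =>
    have hs := (hasSub_fill C t).sizeOf_le
    have hne := ne_of_hasSub hpath (by simp only [Ctx.fill, Tm.out2.sizeOf_spec]; omega)
    simp only [Ctx.fill, outOcc, varOcc, HasSub] at *
    rw [repl, if_neg hne, ih (by tauto) (by omega) hvar]
  | close C ih =>
    have hs := (hasSub_fill C t).sizeOf_le
    have hne := ne_of_hasSub hpath (by simp only [Ctx.fill, Tm.close.sizeOf_spec]; omega)
    simp only [Ctx.fill, outOcc, varOcc, HasSub] at *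
    rw [repl, if_neg hne, ih (by tauto) (by omega) hvar]
  | parL C u ih | parR u C ih | appL C u ih | appR u C ih =>
    have hs := (hasSub_fill C t).sizeOf_le
    have hne := ne_of_hasSub hpath (by
      simp only [Ctx.fill, Tm.par.sizeOf_spec, Tm.app.sizeOf_spec]; omega)
    have h1 := (hasSub_fill C t).outOcc_le w
    have h2 := (hasSub_fill C t).varOcc_le
    simp only [Ctx.fill, outOcc, varOcc, HasSub] at *
    have hu : repl r b σ u = u := repl_eq_self_of_occ hw (by omega) fun z hz => by
      have := hvar z hz
      have := h2 z
      omega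
    rw [repl, if_neg hne, ih (by tauto) (by omega) (fun z hz => by
      have := hvar z hz
      omega), hu]

theorem repl_fill2 {w : ℕ} (hw : 0 < outOcc w r) (D : Ctx2) {a c : Tm}
    (hout : outOcc w (D.fill a c) = 0)
    (hvar : ∀ z, σ z ≠ Tm.var z → varOcc z (D.fill a c) ≤ varOcc z a + varOcc z c) :
    repl r b σ (D.fill a c) = D.fill (repl r b σ a) (repl r b σ c) := by
  have hnot : ∀ {t}, outOcc w t = 0 → ¬ HasSub r t := fun h h' => by
    have := h'.outOcc_le w
    omega
  have hne : D.fill a c ≠ r := fun h => hnot hout (h ▸ hasSub_refl _)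
  induction D with
  | out x D ih | out2 x y D ih | close D ih =>
    simp only [Ctx2.fill, outOcc, varOcc] at *
    have hout' : outOcc w (D.fill a c) = 0 := by omega
    rw [repl, if_neg hne, ih hout' hvar (fun h => hnot hout' (h ▸ hasSub_refl _))]
  | parLL D u ih | parRR u D ih | appLL D u ih | appRR u D ih =>
    simp only [Ctx2.fill, outOcc, varOcc] at *
    have hout' : outOcc w (D.fill a c) = 0 := by omega
    have hu : repl r b σ u = u := repl_eq_self_of_occ hw (by omega) fun z hz => by
      have := hvar z hz
      have := varOcc_le_fill2 D a c z
      omega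
    rw [repl, if_neg hne, ih hout' (fun z hz => by
      have := hvar z hz
      omega) (fun h => hnot hout' (h ▸ hasSub_refl _)), hu]
  | parLR C E | appLR C E =>
    simp only [Ctx2.fill, outOcc, varOcc] at *
    have hC : outOcc w (C.fill a) = 0 := by omega
    have hE : outOcc w (E.fill c) = 0 := by omega
    rw [repl, if_neg hne, repl_fill hw C (Or.inr (hnot hC)) (by omega) fun z hz => by
        have := hvar z hz
        have := (hasSub_fill E c).varOcc_le z
        omega,
      repl_fill hw E (Or.inr (hnot hE)) (by omega) fun z hz => by
        have := hvar z hz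
        have := (hasSub_fill C a).varOcc_le z
        omega]
  | parRL C E | appRL C E =>
    simp only [Ctx2.fill, outOcc, varOcc] at *
    have hC : outOcc w (C.fill c) = 0 := by omega
    have hE : outOcc w (E.fill a) = 0 := by omega
    rw [repl, if_neg hne, repl_fill hw C (Or.inr (hnot hC)) (by omega) fun z hz => by
        have := hvar z hz
        have := (hasSub_fill E a).varOcc_le z
        omega,
      repl_fill hw E (Or.inr (hnot hE)) (by omega) fun z hz => by
        have := hvar z hz
        have := (hasSub_fill C c).varOcc_le z
        omega]

end Fill

/-- every name occurs at most once as a variable and at most once as an output binder -/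
def Linear (t : Tm) : Prop := ∀ z, varOcc z t ≤ 1 ∧ outOcc z t ≤ 1

theorem Redex.exists_outOcc_pos {r b : Tm} {σ : ℕ → Tm} (h : Redex r b σ) :
    ∃ w, 0 < outOcc w r := by
  cases h with
  | app x s u => exact ⟨x, by simp only [outOcc, if_true]; omega⟩
  | out2 x y s t => exact ⟨x, by simp only [outOcc, if_true]; omega⟩

/-- A communication between the redex `(x̄ s) u` in C and the variable x in D. -/
theorem repl_comm {C D : Ctx} {x : ℕ} {s u : Tm}
    (hv : varOcc x (C.fill (Tm.app (Tm.out x s) u)) + varOcc x (D.fill (Tm.var x)) ≤ 1)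
    (ho : outOcc x (C.fill (Tm.app (Tm.out x s) u)) + outOcc x (D.fill (Tm.var x)) ≤ 1) :
    let R := repl (Tm.app (Tm.out x s) u) (Tm.subst x u s) (fun z => if z = x then u else Tm.var z)
    R (C.fill (Tm.app (Tm.out x s) u)) = C.fill s ∧ R (D.fill (Tm.var x)) = D.fill u := by
  have h1 := (hasSub_fill C (Tm.app (Tm.out x s) u)).varOcc_le x
  have h2 := (hasSub_fill D (Tm.var x)).varOcc_le x
  have h3 := (hasSub_fill C (Tm.app (Tm.out x s) u)).outOcc_le x
  have hw : 0 < outOcc x (Tm.app (Tm.out x s) u) := by simp only [outOcc, if_true]; omega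
  have hvar : ∀ z, (if z = x then u else Tm.var z) ≠ Tm.var z → z = x := fun z hz => by
    by_contra h; exact hz (if_neg h)
  have hx : varOcc x (Tm.var x) = 1 := by simp [varOcc]
  have hs : varOcc x s = 0 := by simp only [varOcc] at *; omega
  intro R
  constructor
  · rw [show R = repl _ _ _ from rfl, repl_fill hw C (Or.inl (hasSub_refl _))
      (by simp only [outOcc, if_true] at *; omega)
      (fun z hz => by obtain rfl := hvar z hz; omega), repl_self, subst_eq_self hs]
  · rw [show R = repl _ _ _ from rfl, repl_fill hw D (Or.inr fun h => by
        have := h.outOcc_le x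
        omega) (by omega) (fun z hz => by obtain rfl := hvar z hz; omega)]
    simp [repl]

/-- the substitution performed by a ⅋-reduction -/
abbrev pairSubst (x y : ℕ) (s t : Tm) (z : ℕ) : Tm :=
  if z = y then t else if z = x then s else Tm.var z

theorem pairSubst_ne {x y : ℕ} {s t : Tm} {z : ℕ} (h : pairSubst x y s t z ≠ Tm.var z) :
    z = x ∨ z = y := by
  by_contra! h'
  exact h (by simp [pairSubst, h'.1, h'.2])

theorem repl_fill_out2 {C : Ctx} {x y : ℕ} {s t : Tm}
    (hx : varOcc x (C.fill (Tm.out2 x y (Tm.par s t))) = 0)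
    (hy : varOcc y (C.fill (Tm.out2 x y (Tm.par s t))) = 0)
    (ho : outOcc x (C.fill (Tm.out2 x y (Tm.par s t))) ≤ 1) :
    repl (Tm.out2 x y (Tm.par s t)) Tm.unit (pairSubst x y s t)
      (C.fill (Tm.out2 x y (Tm.par s t))) = C.fill Tm.unit := by
  rw [repl_fill (w := x) (by simp only [outOcc, if_true]; omega) C (Or.inl (hasSub_refl _))
    (by simp only [outOcc, if_true] at *; omega)
    (fun z hz => by rcases pairSubst_ne hz with rfl | rfl <;> omega), repl_self]

theorem repl_fill_var {D : Ctx} {x y v : ℕ} {s t : Tm}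
    (hx : varOcc x (D.fill (Tm.var v)) ≤ varOcc x (Tm.var v))
    (hy : varOcc y (D.fill (Tm.var v)) ≤ varOcc y (Tm.var v))
    (ho : outOcc x (D.fill (Tm.var v)) = 0) :
    repl (Tm.out2 x y (Tm.par s t)) Tm.unit (pairSubst x y s t) (D.fill (Tm.var v)) =
      D.fill (pairSubst x y s t v) := by
  have hw : 0 < outOcc x (Tm.out2 x y (Tm.par s t)) := by simp only [outOcc, if_true]; omega
  rw [repl_fill hw D (Or.inr fun h => by
      have := h.outOcc_le x
      omega) (by omega)
    (fun z hz => by rcases pairSubst_ne hz with rfl | rfl <;> assumption)]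
  simp [repl]

theorem repl_fill2_var {D : Ctx2} {x y : ℕ} {s t : Tm}
    (hx : varOcc x (D.fill (Tm.var x) (Tm.var y)) ≤ 1)
    (hy : varOcc y (D.fill (Tm.var x) (Tm.var y)) ≤ 1)
    (ho : outOcc x (D.fill (Tm.var x) (Tm.var y)) = 0) :
    repl (Tm.out2 x y (Tm.par s t)) Tm.unit (pairSubst x y s t)
      (D.fill (Tm.var x) (Tm.var y)) = D.fill s t := by
  have hw : 0 < outOcc x (Tm.out2 x y (Tm.par s t)) := by simp only [outOcc, if_true]; omega
  have hxx : varOcc x (Tm.var x) = 1 := by simp [varOcc]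
  have hyy : varOcc y (Tm.var y) = 1 := by simp [varOcc]
  have hne : x ≠ y := by
    rintro rfl
    have := varOcc_le_fill2 D (Tm.var x) (Tm.var x) x
    omega
  rw [repl_fill2 hw D ho
    (fun z hz => by rcases pairSubst_ne hz with rfl | rfl <;> omega)]
  simp [repl, pairSubst, hne]

set_option maxHeartbeats 1000000 in
/-- On linear terms, a reduction step contracts a redex globally. -/
theorem Step.exists_redex {a a' : Tm} (h : Step a a') (hl : Linear a) :
    ∃ r b σ, Redex r b σ ∧ HasSub r a ∧ (∀ z, σ z ≠ Tm.var z → 0 < varOcc z a) ∧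
      a' = repl r b σ a := by
  have hsing : ∀ {x : ℕ} {u : Tm} z, (if z = x then u else Tm.var z) ≠ Tm.var z → z = x :=
    fun z hz => by by_contra h; exact hz (if_neg h)
  have hself : ∀ x, varOcc x (Tm.var x) = 1 := by simp [varOcc]
  induction h with
  | beta x u t hx =>
    refine ⟨_, _, _, .app x u t, hasSub_refl _, fun z hz => ?_, repl_self.symm⟩
    obtain rfl := hsing z hz
    simp only [varOcc]
    omega
  | comm1 C D x s u =>
    obtain ⟨hv, ho⟩ := hl x
    obtain ⟨h1, h2⟩ := repl_comm hv ho
    refine ⟨_, _, _, .app x s u, Or.inr (Or.inl (hasSub_fill C _)), fun z hz => ?_, ?_⟩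
    · obtain rfl := hsing z hz
      have := (hasSub_fill D (Tm.var z)).varOcc_le z
      have := hself z
      simp only [varOcc] at *
      omega
    · rw [repl, if_neg (by simp), h1, h2]
  | comm2 C D x s u =>
    obtain ⟨hv, ho⟩ := hl x
    obtain ⟨h1, h2⟩ := repl_comm (C := D) (D := C) (s := s) (u := u)
      ((add_comm _ _).trans_le hv) ((add_comm _ _).trans_le ho)
    refine ⟨_, _, _, .app x s u, Or.inr (Or.inr (hasSub_fill D _)), fun z hz => ?_, ?_⟩
    · obtain rfl := hsing z hz
      have := (hasSub_fill C (Tm.var z)).varOcc_le z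
      have := hself z
      simp only [varOcc] at *
      omega
    · rw [repl, if_neg (by simp), h1, h2]
  | pa1 C D x y s t | pa2 C D x y s t =>
    have hx := hl x
    have hy := hl y
    have h1 := varOcc_le_fill2 D (Tm.var x) (Tm.var y) x
    have h2 := varOcc_le_fill2 D (Tm.var x) (Tm.var y) y
    have h3 := (hasSub_fill C (Tm.out2 x y (Tm.par s t))).outOcc_le x
    have h4 : 0 < outOcc x (Tm.out2 x y (Tm.par s t)) := by simp only [outOcc, if_true]; omega
    rw [hself] at h1 h2
    rw [varOcc, outOcc] at hx hy
    refine ⟨_, _, _, .out2 x y s t, ?_, fun z hz => ?_, ?_⟩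
    · simp [HasSub, hasSub_fill]
    · rw [varOcc]
      rcases pairSubst_ne hz with rfl | rfl <;> omega
    · rw [repl, if_neg (by simp), repl_fill_out2 (by omega) (by omega) (by omega),
        repl_fill2_var (by omega) (by omega) (by omega)]
  | pa3l C D E x y s t | pa3r C D E x y s t | pa4l C D E x y s t | pa4r C D E x y s t =>
    have hx := hl x
    have hy := hl y
    have h1 := fun v => (hasSub_fill D (Tm.var v)).varOcc_le v
    have h2 := fun v => (hasSub_fill E (Tm.var v)).varOcc_le v
    simp only [hself] at h1 h2
    have h1x := h1 x
    have h1y := h1 y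
    have h2x := h2 x
    have h2y := h2 y
    have h3x := (hasSub_fill C (Tm.out2 x y (Tm.par s t))).outOcc_le x
    have h4 : 0 < outOcc x (Tm.out2 x y (Tm.par s t)) := by simp only [outOcc, if_true]; omega
    have h5 := hself x
    have h6 := hself y
    have hne : x ≠ y := by
      rintro rfl
      simp only [varOcc, outOcc] at hx h1x h2x
      omega
    simp only [outOcc.eq_4, varOcc.eq_4] at hx hy
    refine ⟨_, _, _, .out2 x y s t, ?_, fun z hz => ?_, ?_⟩
    · simp [HasSub, hasSub_fill]
    · simp only [varOcc.eq_4]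
      rcases pairSubst_ne hz with rfl | rfl <;> omega
    · rw [repl, if_neg (by simp), repl, if_neg (by simp),
        repl_fill_out2 (by omega) (by omega) (by omega),
        repl_fill_var (by omega) (by omega) (by omega),
        repl_fill_var (by omega) (by omega) (by omega)]
      simp [pairSubst, hne]
  | ctx C h ih =>
    rename_i t u
    have hsub := hasSub_fill C t
    obtain ⟨r, b, σ, hr, hs, hv, rfl⟩ := ih fun z =>
      ⟨(hsub.varOcc_le z).trans (hl z).1, (hsub.outOcc_le z).trans (hl z).2⟩
    obtain ⟨w, hw⟩ := hr.exists_outOcc_pos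
    refine ⟨r, b, σ, hr, ?_, fun z hz => (hv z hz).trans_le (hsub.varOcc_le z), ?_⟩
    · clear * - hs
      induction C with
      | hole => exact hs
      | _ => simp_all [Ctx.fill, HasSub]
    · refine (repl_fill hw C (Or.inl hs) ?_ fun z hz => ?_).symm
      · have := hs.outOcc_le w
        have := (hl w).2
        omega
      · have := hv z hz
        have := (hl z).1
        omega

/-- an additive measure on terms is summed over the components of a parallel composition -/
theorem bigPar_measure (f : Tm → ℕ) (hf : ∀ s t, f (Tm.par s t) = f s + f t) {l : List Tm}
    (hl : l ≠ []) : f (bigPar l) = (l.map f).sum := by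
  cases l with
  | nil => exact absurd rfl hl
  | cons t ts =>
    rw [bigPar, List.map_cons, List.sum_cons]
    clear hl
    induction ts generalizing t with
    | nil => simp
    | cons u us ih => rw [List.foldl_cons, ih, hf, List.map_cons, List.sum_cons, add_assoc]

theorem repl_bigPar {r b : Tm} {σ : ℕ → Tm} (hr : ¬ r.IsValue) {l : List Tm} (hl : l ≠ []) :
    repl r b σ (bigPar l) = bigPar (l.map (repl r b σ)) := by
  have hpar : ∀ s t, repl r b σ (Tm.par s t) = Tm.par (repl r b σ s) (repl r b σ t) :=
    fun s t => by rw [repl, if_neg]; rintro rfl; exact hr trivial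
  cases l with
  | nil => exact absurd rfl hl
  | cons t ts =>
    rw [List.map_cons, bigPar, bigPar]
    clear hl
    induction ts generalizing t with
    | nil => rfl
    | cons u us ih => rw [List.foldl_cons, ih, hpar, List.map_cons, List.foldl_cons]

theorem hasSub_bigPar {r : Tm} (hr : ¬ r.IsValue) {l : List Tm} (hl : l ≠ [])
    (h : HasSub r (bigPar l)) : ∃ t ∈ l, HasSub r t := by
  cases l with
  | nil => exact absurd rfl hl
  | cons t ts =>
    rw [bigPar] at h
    clear hl
    induction ts generalizing t with
    | nil => exact ⟨t, by simp, h⟩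
    | cons u us ih =>
      obtain ⟨v, hv, hs⟩ := ih _ h
      rcases List.mem_cons.mp hv with rfl | hv
      · rcases hs with rfl | hs | hs
        · exact absurd trivial hr
        · exact ⟨t, by simp, hs⟩
        · exact ⟨u, by simp, hs⟩
      · exact ⟨v, by simp [hv], hs⟩

theorem bigPar_injective {l l' : List Tm} (hlen : l.length = l'.length)
    (h : bigPar l = bigPar l') : l = l' := by
  have key : ∀ (us us' : List Tm) (t t' : Tm), us.length = us'.length →
      us.foldl Tm.par t = us'.foldl Tm.par t' → t = t' ∧ us = us' := by
    intro us
    induction us with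
    | nil =>
      intro us' t t' hlen h
      obtain rfl := List.length_eq_zero_iff.mp hlen.symm
      exact ⟨h, rfl⟩
    | cons u us ih =>
      intro us' t t' hlen h
      cases us' with
      | nil => simp at hlen
      | cons u' us' =>
        obtain ⟨h1, rfl⟩ := ih us' _ _ (by simpa using hlen) h
        cases h1
        exact ⟨rfl, rfl⟩
  cases l with
  | nil => exact (List.length_eq_zero_iff.mp hlen.symm).symm
  | cons t ts =>
    cases l' with
    | nil => simp at hlen
    | cons t' ts' =>
      obtain ⟨rfl, rfl⟩ := key ts ts' t t' (by simpa using hlen) h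
      rfl

theorem Redex.not_isValue {r b : Tm} {σ : ℕ → Tm} (h : Redex r b σ) : ¬ r.IsValue := by
  cases h <;> exact id

/-- Subject Reduction. -/
theorem subject_reduction (Γ : Multiset (ℕ × Ty)) (δ δ' : List Entry)
    (d : NMLL Γ (↑δ : Multiset Entry))
    (hne : δ ≠ [])
    (hty : δ.map Prod.snd = δ'.map Prod.snd)
    (hstep : Step (bigPar (δ.map Prod.fst)) (bigPar (δ'.map Prod.fst))) :
    Nonempty (NMLL Γ (↑δ' : Multiset Entry)) := by
  have hne' : δ.map Prod.fst ≠ [] := by simpa using hne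
  have hlin : Linear (bigPar (δ.map Prod.fst)) := by
    intro z
    have hv : varOcc z (bigPar (δ.map Prod.fst)) = varOccM z (δ : Multiset Entry) := by
      rw [bigPar_measure (varOcc z) (fun _ _ => rfl) hne']
      simp [varOccM, Function.comp_def]
    have ho : outOcc z (bigPar (δ.map Prod.fst)) = outOccM z (δ : Multiset Entry) := by
      rw [bigPar_measure (outOcc z) (fun _ _ => rfl) hne']
      simp [outOccM, Function.comp_def]
    have := d.linear z
    omega
  obtain ⟨r, b, σ, hr, hs, -, heq⟩ := hstep.exists_redex hlin
  obtain ⟨t, ht, hs⟩ := hasSub_bigPar hr.not_isValue hne' hs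
  obtain ⟨e, he, rfl⟩ := List.mem_map.mp ht
  rw [repl_bigPar hr.not_isValue hne'] at heq
  have hlen : δ.length = δ'.length := by simpa using congrArg List.length hty
  have hfst := bigPar_injective (by simp [hlen]) heq
  have hδ' : δ' = δ.map (replEntry r b σ) := by
    refine List.ext_getElem (by simp [hlen]) fun i h1 h2 => Prod.ext ?_ ?_
    · have := List.getElem_of_eq hfst (i := i) (by simpa using h1)
      simpa [replEntry] using this
    · have := List.getElem_of_eq hty (i := i) (by simpa [hlen] using h1)
      simpa [replEntry] using this.symm
  rw [hδ', ← Multiset.map_coe]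
  exact d.contract hr ⟨e, he, hs⟩
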